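/- Under the white-noise sequence model with a spike-and-slab prior satisfying Assumption A2 (δ > 1/4, slab radius R exceeding the uniform sup-norm bound of the class) and Assumption A1 on (t,M,η), there exist constants a > 0 (determined by δ) and A > a such that, uniformly over f₀ ∈ C(t,M,η): E_{f₀} Π[ T : T ∩ S(f₀,a)^c ≠ ∅ | Y ] = o(1) and E_{f₀} Π[ T : S(f₀,A) ⊄ T | Y ] = o(1) as n → ∞, where S(f₀,b) = {(l,k) : l ≤ L_max, |β⁰_{lk}| > b √(log n/n)}. -/

import Mathlib

open MeasureTheory Filter Set ProbabilityTheory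
open scoped ENNReal NNReal Classical BigOperators

noncomputable section

namespace Spatial

/-- the mother Haar wavelet ψ = 1_{(0,1/2]} − 1_{(1/2,1]} -/
def psi (x : ℝ) : ℝ :=
  if x ∈ Set.Ioc (0 : ℝ) (1 / 2) then 1 else if x ∈ Set.Ioc (1 / 2 : ℝ) 1 then -1 else 0

/-- the Haar wavelet ψ_{lk}(x) = 2^{l/2} ψ(2^l x − k) -/
def haar (l k : ℕ) (x : ℝ) : ℝ := (2 : ℝ) ^ ((l : ℝ) / 2) * psi ((2 : ℝ) ^ l * x - k)

/-- the father wavelet ψ_{−1,0} = 1_{[0,1]} -/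
def father (x : ℝ) : ℝ := if x ∈ Set.Icc (0 : ℝ) 1 then 1 else 0

/-- the dyadic interval I_{lk} = (k 2^{−l}, (k+1) 2^{−l}] -/
def dyadic (l k : ℕ) : Set ℝ := Set.Ioc ((k : ℝ) / 2 ^ l) (((k : ℝ) + 1) / 2 ^ l)

/-- the Haar coefficient β⁰_{lk} = ∫₀¹ f ψ_{lk} -/
def coef (f : ℝ → ℝ) (l k : ℕ) : ℝ := ∫ x in Set.Ioc (0 : ℝ) 1, f x * haar l k x

/-- the father coefficient ⟨f, ψ_{−1,0}⟩ -/
def coefFather (f : ℝ → ℝ) : ℝ := ∫ x in Set.Ioc (0 : ℝ) 1, f x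

/-- k_l(x) : the index k with x ∈ I_{lk} (for x ∈ (0,1]) -/
def kAt (l : ℕ) (x : ℝ) : ℕ := ⌈(2 : ℝ) ^ l * x⌉₊ - 1

/-- f belongs to the local Hölder class C(t,x,M,η) at the point x -/
def HolderAt (f : ℝ → ℝ) (t M η : ℝ) (x : ℝ) : Prop :=
  (∀ y ∈ Set.Icc (0 : ℝ) 1, |f y| ≤ M) ∧
    ∀ m : ℝ, m ≠ 0 → |m| ≤ η → x + m ∈ Set.Icc (0 : ℝ) 1 →
      |f (x + m) - f x| ≤ M * |m| ^ t

/-- the class C(t,M,η) of locally Hölder functions -/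
def HolderClass (t M η : ℝ → ℝ) : Set (ℝ → ℝ) :=
  {f | ∀ x ∈ Set.Icc (0 : ℝ) 1, HolderAt f (t x) (M x) (η x) x}

/-- Assumption A1 on the smoothness functions t, M, η -/
structure A1 (t M η : ℝ → ℝ) (t₁ : ℝ) : Prop where
  ht₁ : 0 < t₁
  t_lb : ∀ x ∈ Set.Icc (0 : ℝ) 1, t₁ ≤ t x
  t_ub : ∀ x ∈ Set.Icc (0 : ℝ) 1, t x ≤ 1
  M_ub : ∃ Mmax > 0, ∀ x ∈ Set.Icc (0 : ℝ) 1, M x ≤ Mmax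
  M_lb : ∃ Mmin > 0, ∀ x ∈ Set.Icc (0 : ℝ) 1, Mmin ≤ M x
  eta_ub : ∃ emax > 0, ∀ x ∈ Set.Icc (0 : ℝ) 1, η x ≤ emax
  eta_lb : ∃ emin > 0, ∀ x ∈ Set.Icc (0 : ℝ) 1, emin ≤ η x

/-- η_{lk} = min_{y ∈ I_{lk}} η(y) -/
def etaLK (η : ℝ → ℝ) (l k : ℕ) : ℝ := sInf (η '' dyadic l k)

/-- M_{lk} = max_{y ∈ I_{lk}} M(y) -/
def MLK (M : ℝ → ℝ) (l k : ℕ) : ℝ := sSup (M '' dyadic l k)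

/-- the local rate ζ_n(x) = (n/log n)^{t(x)/(2t(x)+1)} -/
def zeta (t : ℝ → ℝ) (n : ℕ) (x : ℝ) : ℝ :=
  ((n : ℝ) / Real.log n) ^ (t x / (2 * t x + 1))

/-- maximal resolution L_max = ⌊log₂ n⌋ -/
def Lmax (n : ℕ) : ℕ := Nat.log 2 n

/-- C_l(x) = (2 M_{l k_l(x)}/γ̄)^{1/(t(x)+1/2)} -/
def Cl (t M : ℝ → ℝ) (γ : ℝ) (l : ℕ) (x : ℝ) : ℝ :=
  (2 * MLK M l (kAt l x) / γ) ^ ((1 : ℝ) / (t x + 1 / 2))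

/-- the local depth d_l(x) -/
def dloc (t M : ℝ → ℝ) (γ : ℝ) (n l : ℕ) (x : ℝ) : ℝ :=
  (⌊Real.logb 2 (Cl t M γ l x * ((n : ℝ) / Real.log n) ^ ((1 : ℝ) / (2 * t x + 1)))⌋ : ℝ)

/-- the adjusted local depth d̃_l(x) -/
def dTilde (t M η : ℝ → ℝ) (γ : ℝ) (n l : ℕ) (x : ℝ) : ℝ :=
  max (Real.logb 2 (1 / (2 * etaLK η l (kAt l x)))) (dloc t M γ n l x)


/-! ## Spike-and-slab priors in the white noise model -/

/-- all wavelet nodes (l,k) with l ≤ Lmax n -/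
def allNodes (n : ℕ) : Finset (ℕ × ℕ) :=
  (Finset.range (Lmax n + 1)).biUnion fun l => (Finset.range (2 ^ l)).image fun k => (l, k)

/-- embedding of a finitely supported coefficient vector -/
def embedFin (A : Finset (ℕ × ℕ)) (v : {p : ℕ × ℕ // p ∈ A} → ℝ) : (ℕ × ℕ) → ℝ :=
  fun p => if h : p ∈ A then v ⟨p, h⟩ else 0

/-- the standard Gaussian on ℝ -/
def stdGaussian : Measure ℝ := ProbabilityTheory.gaussianReal 0 1

/-- a spike-and-slab prior: weights on subsets of nodes and slab densities -/
structure SSPrior (n : ℕ) where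
  w : Finset (ℕ × ℕ) → ℝ
  slab : ℕ × ℕ → ℝ → ℝ

/-- Assumption A2 on the spike-and-slab prior -/
structure A2 (n : ℕ) (P : SSPrior n) (cT CT Bω δ R cR CR : ℝ) (ω : ℕ → ℝ) : Prop where
  w_nonneg : ∀ T, 0 ≤ P.w T
  w_support : ∀ T : Finset (ℕ × ℕ), ¬T ⊆ allNodes n → P.w T = 0
  w_sum : ∑' T : Finset (ℕ × ℕ), P.w T = 1
  ω_pos : ∀ l ≤ Lmax n, 0 < ω l
  ratio_lb : ∀ T : Finset (ℕ × ℕ), ∀ p ∈ allNodes n, p ∉ T →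
    cT * ω p.1 * P.w T ≤ P.w (insert p T)
  ratio_ub : ∀ T : Finset (ℕ × ℕ), ∀ p ∈ allNodes n, p ∉ T →
    P.w (insert p T) ≤ CT * ω p.1 * P.w T
  ω_lb : ∀ l ≤ Lmax n, (n : ℝ) ^ (-Bω) ≤ ω l
  ω_ub : ∀ l ≤ Lmax n, ω l ≤ (n : ℝ) ^ ((1 - δ) / 2) / 2 ^ l
  slab_nonneg : ∀ p b, 0 ≤ P.slab p b
  slab_lb : ∀ p : ℕ × ℕ, ∀ b : ℝ, |b| ≤ R → cR ≤ P.slab p b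
  slab_ub : ∀ p b, P.slab p b ≤ CR
  slab_prob : ∀ p : ℕ × ℕ, ∫ b : ℝ, P.slab p b = 1

/-- conditional spike-and-slab prior on the coefficients given the active set T -/
def ssCondPrior (n : ℕ) (P : SSPrior n) (T : Finset (ℕ × ℕ)) :
    Measure ((ℕ × ℕ) → ℝ) :=
  Measure.map (embedFin T)
    ((volume : Measure ({p : ℕ × ℕ // p ∈ T} → ℝ)).withDensity fun v =>
      ENNReal.ofReal (∏ p : {p : ℕ × ℕ // p ∈ T}, P.slab p (v p)))

/-- the spike-and-slab prior on the coefficients -/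
def ssPrior (n : ℕ) (P : SSPrior n) : Measure ((ℕ × ℕ) → ℝ) :=
  Measure.sum fun T : Finset (ℕ × ℕ) => ENNReal.ofReal (P.w T) • ssCondPrior n P T

/-- white-noise log-likelihood for a wavelet coefficient sequence -/
def ssLoglik (n : ℕ) (Y β : (ℕ × ℕ) → ℝ) : ℝ :=
  -((n : ℝ) / 2) * ∑ p ∈ allNodes n, (Y p - β p) ^ 2

/-- posterior probability of a set of coefficient sequences -/
def ssPost (n : ℕ) (P : SSPrior n) (Y : (ℕ × ℕ) → ℝ) (A : Set ((ℕ × ℕ) → ℝ)) : ℝ :=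
  (∫ β in A, Real.exp (ssLoglik n Y β) ∂ssPrior n P) /
    ∫ β, Real.exp (ssLoglik n Y β) ∂ssPrior n P

/-- the marginal likelihood of an active set T -/
def ssMarg (n : ℕ) (P : SSPrior n) (Y : (ℕ × ℕ) → ℝ) (T : Finset (ℕ × ℕ)) : ℝ :=
  ∫ β, Real.exp (ssLoglik n Y β) ∂ssCondPrior n P T

/-- the posterior probability of a collection of active sets -/
def ssSetPost (n : ℕ) (P : SSPrior n) (Y : (ℕ × ℕ) → ℝ)
    (A : Set (Finset (ℕ × ℕ))) : ℝ :=
  (∑' T : Finset (ℕ × ℕ), if T ∈ A then P.w T * ssMarg n P Y T else 0) /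
    ∑' T : Finset (ℕ × ℕ), P.w T * ssMarg n P Y T

/-- the noise distribution -/
def ssNoise (n : ℕ) : Measure ((ℕ × ℕ) → ℝ) :=
  Measure.map (embedFin (allNodes n))
    (Measure.pi fun _ : {p : ℕ × ℕ // p ∈ allNodes n} => stdGaussian)

/-- the observation Y_{lk} = β⁰_{lk} + ε_{lk}/√n -/
def ssObs (f₀ : ℝ → ℝ) (n : ℕ) (ε : (ℕ × ℕ) → ℝ) : (ℕ × ℕ) → ℝ :=
  fun p => coef f₀ p.1 p.2 + ε p / Real.sqrt n

/-- the function represented by a coefficient sequence -/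
def ssF (n : ℕ) (β : (ℕ × ℕ) → ℝ) (x : ℝ) : ℝ :=
  ∑ p ∈ allNodes n, β p * haar p.1 p.2 x

/-- the signal nodes S(f₀,b) = {(l,k) : |β⁰_{lk}| > b √(log n/n)} -/
def sigSet (f₀ : ℝ → ℝ) (n : ℕ) (b : ℝ) : Finset (ℕ × ℕ) :=
  (allNodes n).filter fun p =>
    b * Real.sqrt (Real.log n / n) < |coef f₀ p.1 p.2|


theorem sum_powerset_mem_le {α : Type*} [DecidableEq α] {N : Finset α} {g : Finset α → ℝ}
    (hg : ∀ T, 0 ≤ g T) {p : α} (hp : p ∈ N) {r : ℝ} (hr : 0 ≤ r)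
    (h : ∀ T ⊆ N, p ∉ T → g (insert p T) ≤ r * g T) :
    ∑ T ∈ N.powerset with p ∈ T, g T ≤ r * ∑ T ∈ N.powerset, g T := by
  have hsub : ∀ T ∈ (N.erase p).powerset, T ⊆ N ∧ p ∉ T := fun T hT => by
    rw [Finset.mem_powerset] at hT
    exact ⟨hT.trans (Finset.erase_subset _ _), fun hpT => Finset.notMem_erase p N (hT hpT)⟩
  rw [Finset.sum_filter]
  nth_rewrite 1 2 [← Finset.insert_erase hp]
  rw [Finset.sum_powerset_insert (Finset.notMem_erase p N),
    Finset.sum_powerset_insert (Finset.notMem_erase p N), mul_add]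
  have h1 : ∑ T ∈ (N.erase p).powerset, (if p ∈ T then g T else 0) = 0 :=
    Finset.sum_eq_zero fun T hT => if_neg (hsub T hT).2
  have h2 : ∑ T ∈ (N.erase p).powerset, (if p ∈ insert p T then g (insert p T) else 0) ≤
      r * ∑ T ∈ (N.erase p).powerset, g T := by
    rw [Finset.mul_sum]
    refine Finset.sum_le_sum fun T hT => ?_
    rw [if_pos (Finset.mem_insert_self p T)]
    exact h T (hsub T hT).1 (hsub T hT).2
  have h3 : 0 ≤ r * ∑ T ∈ (N.erase p).powerset, g (insert p T) :=
    mul_nonneg hr (Finset.sum_nonneg fun T _ => hg _)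
  linarith

theorem sum_powerset_notMem_le {α : Type*} [DecidableEq α] {N : Finset α} {g : Finset α → ℝ}
    (hg : ∀ T, 0 ≤ g T) {p : α} (hp : p ∈ N) {r : ℝ} (hr : 0 ≤ r)
    (h : ∀ T ⊆ N, p ∉ T → g T ≤ r * g (insert p T)) :
    ∑ T ∈ N.powerset with p ∉ T, g T ≤ r * ∑ T ∈ N.powerset, g T := by
  have hsub : ∀ T ∈ (N.erase p).powerset, T ⊆ N ∧ p ∉ T := fun T hT => by
    rw [Finset.mem_powerset] at hT
    exact ⟨hT.trans (Finset.erase_subset _ _), fun hpT => Finset.notMem_erase p N (hT hpT)⟩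
  rw [Finset.sum_filter]
  nth_rewrite 1 2 [← Finset.insert_erase hp]
  rw [Finset.sum_powerset_insert (Finset.notMem_erase p N),
    Finset.sum_powerset_insert (Finset.notMem_erase p N), mul_add]
  have h1 : ∑ T ∈ (N.erase p).powerset, (if p ∉ insert p T then g (insert p T) else 0) = 0 :=
    Finset.sum_eq_zero fun T _ => if_neg (not_not.2 (Finset.mem_insert_self p T))
  have h2 : ∑ T ∈ (N.erase p).powerset, (if p ∉ T then g T else 0) ≤
      r * ∑ T ∈ (N.erase p).powerset, g (insert p T) := by
    rw [Finset.mul_sum]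
    refine Finset.sum_le_sum fun T hT => ?_
    rw [if_pos (hsub T hT).2]
    exact h T (hsub T hT).1 (hsub T hT).2
  have h3 : 0 ≤ r * ∑ T ∈ (N.erase p).powerset, g T :=
    mul_nonneg hr (Finset.sum_nonneg fun T _ => hg _)
  linarith

theorem measurable_embedFin (T : Finset (ℕ × ℕ)) : Measurable (embedFin T) := by
  refine measurable_pi_lambda _ fun p => ?_
  by_cases h : p ∈ T
  · simpa [embedFin, h] using measurable_pi_apply (⟨p, h⟩ : {p : ℕ × ℕ // p ∈ T})
  · simp [embedFin, h]

/-- the marginal likelihood of an observation `y` of a coefficient drawn from the slab at `p` -/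
def slabMarg (n : ℕ) (P : SSPrior n) (p : ℕ × ℕ) (y : ℝ) : ℝ :=
  ∫ b, Real.exp (-((n : ℝ) / 2) * (y - b) ^ 2) * P.slab p b

theorem ssMarg_nonneg (n : ℕ) (P : SSPrior n) (Y : ℕ × ℕ → ℝ) (T : Finset (ℕ × ℕ)) :
    0 ≤ ssMarg n P Y T :=
  integral_nonneg fun _ => (Real.exp_pos _).le

section Prior

variable {n : ℕ} {P : SSPrior n} {cT CT Bω δ R cR CR : ℝ} {ω : ℕ → ℝ}

theorem A2.integrable_slab (h : A2 n P cT CT Bω δ R cR CR ω) (p : ℕ × ℕ) :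
    Integrable (P.slab p) := by
  by_contra hc
  simpa [integral_undef hc] using h.slab_prob p

theorem A2.integrable_exp_mul_slab (h : A2 n P cT CT Bω δ R cR CR ω) (p : ℕ × ℕ) (y : ℝ) :
    Integrable fun b => Real.exp (-((n : ℝ) / 2) * (y - b) ^ 2) * P.slab p b := by
  refine (h.integrable_slab p).bdd_mul (c := 1) (by fun_prop) (ae_of_all _ fun b => ?_)
  rw [Real.norm_eq_abs, Real.abs_exp, Real.exp_le_one_iff]
  have : 0 ≤ (n : ℝ) / 2 * (y - b) ^ 2 := by positivity
  linarith

theorem A2.slabMarg_le (h : A2 n P cT CT Bω δ R cR CR ω) (hn : 0 < n) (p : ℕ × ℕ) (y : ℝ) :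
    slabMarg n P p y ≤ CR * √(2 * Real.pi / n) := by
  have hn' : (0 : ℝ) < n := by exact_mod_cast hn
  have hg : Integrable fun b : ℝ => Real.exp (-((n : ℝ) / 2) * (y - b) ^ 2) :=
    (integrable_exp_neg_mul_sq (half_pos hn')).comp_sub_left y
  calc slabMarg n P p y ≤ ∫ b : ℝ, Real.exp (-((n : ℝ) / 2) * (y - b) ^ 2) * CR :=
        integral_mono (h.integrable_exp_mul_slab p y) (hg.mul_const CR) fun b =>
          mul_le_mul_of_nonneg_left (h.slab_ub p b) (Real.exp_pos _).le
    _ = CR * √(2 * Real.pi / n) := by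
        rw [integral_mul_const,
          integral_sub_left_eq_self (fun b : ℝ => Real.exp (-((n : ℝ) / 2) * b ^ 2)) volume y,
          integral_gaussian, mul_comm]
        congr 2
        field_simp

theorem A2.le_slabMarg (h : A2 n P cT CT Bω δ R cR CR ω) (hn : 0 < n) (hcR : 0 < cR)
    (p : ℕ × ℕ) {y : ℝ} (hy : |y| + 1 / √n ≤ R) :
    2 * cR * Real.exp (-(1 / 2)) / √n ≤ slabMarg n P p y := by
  have hn' : (0 : ℝ) < n := by exact_mod_cast hn
  have hs : 0 < √(n : ℝ) := Real.sqrt_pos.2 hn'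
  have hint := h.integrable_exp_mul_slab p y
  have hnn : ∀ b, 0 ≤ Real.exp (-((n : ℝ) / 2) * (y - b) ^ 2) * P.slab p b := fun b =>
    mul_nonneg (Real.exp_pos _).le (h.slab_nonneg p b)
  refine le_trans ?_ (setIntegral_le_integral (s := Set.Icc (y - 1 / √n) (y + 1 / √n)) hint
    (ae_of_all _ hnn))
  refine le_trans (le_of_eq ?_) (setIntegral_ge_of_const_le_real (c := Real.exp (-(1 / 2)) * cR)
    measurableSet_Icc (by simp) (fun b hb => ?_) hint.integrableOn)
  · rw [measureReal_def, Real.volume_Icc, ENNReal.toReal_ofReal (by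
      have : 0 < 1 / √(n : ℝ) := by positivity
      linarith)]
    field_simp
    ring
  · have hyb : |y - b| ≤ 1 / √n := abs_le.2 ⟨by linarith [hb.2], by linarith [hb.1]⟩
    have hsq : (y - b) ^ 2 ≤ 1 / n := by
      have := sq_le_sq' (abs_le.1 hyb).1 (abs_le.1 hyb).2
      rwa [div_pow, Real.sq_sqrt hn'.le, one_pow] at this
    have hexp : -(1 / 2) ≤ -((n : ℝ) / 2) * (y - b) ^ 2 := by
      have := mul_le_mul_of_nonneg_left hsq hn'.le
      rw [mul_one_div_cancel hn'.ne'] at this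
      linarith
    have hbR : |b| ≤ R := by
      have := abs_sub_abs_le_abs_sub b y
      rw [abs_sub_comm] at this
      linarith
    exact mul_le_mul (Real.exp_le_exp.2 hexp) (h.slab_lb p b hbR) hcR.le (Real.exp_pos _).le

theorem A2.ssMarg_eq (h : A2 n P cT CT Bω δ R cR CR ω) (Y : ℕ × ℕ → ℝ) {T : Finset (ℕ × ℕ)}
    (hT : T ⊆ allNodes n) :
    ssMarg n P Y T = (∏ p ∈ T, slabMarg n P p (Y p)) *
      ∏ p ∈ allNodes n \ T, Real.exp (-((n : ℝ) / 2) * Y p ^ 2) := by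
  have hprod : AEMeasurable
      (fun v : {p : ℕ × ℕ // p ∈ T} → ℝ => ∏ p : {p : ℕ × ℕ // p ∈ T}, P.slab p (v p)) volume :=
    (Integrable.fintype_prod (f := fun (p : {p : ℕ × ℕ // p ∈ T}) => P.slab p)
      fun p => h.integrable_slab p).aestronglyMeasurable.aemeasurable
  have hlik : Measurable fun β : ℕ × ℕ → ℝ => Real.exp (ssLoglik n Y β) := by
    unfold ssLoglik
    fun_prop
  have hfun : ∀ v : {p : ℕ × ℕ // p ∈ T} → ℝ,
      (ENNReal.ofReal (∏ p : {p : ℕ × ℕ // p ∈ T}, P.slab p (v p))).toReal • Real.exp (ssLoglik n Y (embedFin T v)) =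
      (∏ p : {p : ℕ × ℕ // p ∈ T},
        Real.exp (-((n : ℝ) / 2) * (Y p - v p) ^ 2) * P.slab p (v p)) *
      ∏ p ∈ allNodes n \ T, Real.exp (-((n : ℝ) / 2) * Y p ^ 2) := fun v => by
    rw [ENNReal.toReal_ofReal (Finset.prod_nonneg fun p _ => h.slab_nonneg _ _), ssLoglik,
      Finset.mul_sum, Real.exp_sum, ← Finset.prod_sdiff hT, Finset.prod_mul_distrib, smul_eq_mul,
      ← Finset.prod_coe_sort T]
    have h1 : ∏ p ∈ allNodes n \ T, Real.exp (-((n : ℝ) / 2) * (Y p - embedFin T v p) ^ 2) =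
        ∏ p ∈ allNodes n \ T, Real.exp (-((n : ℝ) / 2) * Y p ^ 2) :=
      Finset.prod_congr rfl fun p hp => by simp [embedFin, (Finset.mem_sdiff.1 hp).2]
    have h2 : ∏ p : {p : ℕ × ℕ // p ∈ T},
        Real.exp (-((n : ℝ) / 2) * (Y p - embedFin T v p) ^ 2) =
        ∏ p : {p : ℕ × ℕ // p ∈ T}, Real.exp (-((n : ℝ) / 2) * (Y p - v p) ^ 2) :=
      Finset.prod_congr rfl fun p _ => by simp [embedFin]
    rw [h1, h2]
    ring
  rw [ssMarg, ssCondPrior, integral_map (measurable_embedFin T).aemeasurable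
      hlik.aestronglyMeasurable,
    integral_withDensity_eq_integral_toReal_smul₀ hprod.ennreal_ofReal (by simp)]
  simp_rw [hfun]
  rw [integral_mul_const, integral_fintype_prod_volume_eq_prod
    (fun (p : {p : ℕ × ℕ // p ∈ T}) (b : ℝ) =>
      Real.exp (-((n : ℝ) / 2) * (Y p - b) ^ 2) * P.slab p b),
    ← Finset.prod_coe_sort T]
  rfl

theorem A2.ssMarg_insert (h : A2 n P cT CT Bω δ R cR CR ω) (Y : ℕ × ℕ → ℝ)
    {T : Finset (ℕ × ℕ)} (hT : T ⊆ allNodes n) {p : ℕ × ℕ} (hp : p ∈ allNodes n) (hpT : p ∉ T) :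
    ssMarg n P Y (insert p T) =
      Real.exp ((n : ℝ) / 2 * Y p ^ 2) * slabMarg n P p (Y p) * ssMarg n P Y T := by
  have hsd : allNodes n \ T = insert p (allNodes n \ insert p T) := by
    ext q
    by_cases hq : q = p <;> simp [hq, hp, hpT]
  rw [h.ssMarg_eq Y hT, h.ssMarg_eq Y (Finset.insert_subset hp hT), Finset.prod_insert hpT, hsd,
    Finset.prod_insert (by simp), neg_mul, Real.exp_neg]
  field_simp

theorem A2.ssSetPost_le (h : A2 n P cT CT Bω δ R cR CR ω) (Y : ℕ × ℕ → ℝ)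
    {A : Set (Finset (ℕ × ℕ))} {Q : Finset (ℕ × ℕ)} {C : ℕ × ℕ → Finset (ℕ × ℕ) → Prop}
    [∀ p, DecidablePred (C p)]
    (hA : ∀ T ⊆ allNodes n, T ∈ A → ∃ p ∈ Q, C p T) {b : ℕ × ℕ → ℝ} (hb : ∀ p ∈ Q, 0 ≤ b p)
    (hC : ∀ p ∈ Q, ∑ T ∈ (allNodes n).powerset with C p T, P.w T * ssMarg n P Y T ≤
      b p * ∑ T ∈ (allNodes n).powerset, P.w T * ssMarg n P Y T) :
    ssSetPost n P Y A ≤ ∑ p ∈ Q, b p := by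
  have hw : ∀ T ∉ (allNodes n).powerset, P.w T = 0 := fun T hT =>
    h.w_support T (by simpa using hT)
  have hg : ∀ T, 0 ≤ P.w T * ssMarg n P Y T := fun T =>
    mul_nonneg (h.w_nonneg T) (ssMarg_nonneg n P Y T)
  rw [ssSetPost, tsum_eq_sum (s := (allNodes n).powerset) fun T hT => by simp [hw T hT],
    tsum_eq_sum (s := (allNodes n).powerset) fun T hT => by simp [hw T hT]]
  refine div_le_of_le_mul₀ (Finset.sum_nonneg fun T _ => hg T) (Finset.sum_nonneg hb) ?_
  rw [Finset.sum_mul]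
  refine le_trans ?_ (Finset.sum_le_sum hC)
  simp_rw [Finset.sum_filter]
  rw [Finset.sum_comm]
  refine Finset.sum_le_sum fun T hT => ?_
  have hnn : ∀ p ∈ Q, 0 ≤ if C p T then P.w T * ssMarg n P Y T else 0 := fun p _ => by
    split_ifs
    exacts [hg T, le_rfl]
  by_cases hTA : T ∈ A
  · obtain ⟨p, hp, hpT⟩ := hA T (Finset.mem_powerset.1 hT) hTA
    rw [if_pos hTA]
    exact (if_pos hpT).ge.trans (Finset.single_le_sum hnn hp)
  · rw [if_neg hTA]
    exact Finset.sum_nonneg hnn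

theorem A2.ssSetPost_nonneg (h : A2 n P cT CT Bω δ R cR CR ω) (Y : ℕ × ℕ → ℝ)
    (A : Set (Finset (ℕ × ℕ))) : 0 ≤ ssSetPost n P Y A := by
  have hg : ∀ T, 0 ≤ P.w T * ssMarg n P Y T := fun T =>
    mul_nonneg (h.w_nonneg T) (ssMarg_nonneg n P Y T)
  refine div_nonneg (tsum_nonneg fun T => ?_) (tsum_nonneg hg)
  split_ifs
  exacts [hg T, le_rfl]

end Prior

instance : IsProbabilityMeasure stdGaussian := by
  unfold stdGaussian
  infer_instance

theorem stdGaussian_real_compl_Icc_le {K : ℝ} (hK : 0 ≤ K) :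
    stdGaussian.real (Set.Icc (-K) K)ᶜ ≤ 2 * Real.exp (-K ^ 2 / 2) := by
  have hmgf : ∀ s : ℝ, mgf id stdGaussian s = Real.exp (s ^ 2 / 2) := fun s => by
    simp [stdGaussian, mgf_id_gaussianReal]
  have h1 := measure_ge_le_exp_mul_mgf (μ := stdGaussian) (X := id) (t := K) K hK
    (integrable_exp_mul_gaussianReal K)
  have h2 := measure_le_le_exp_mul_mgf (μ := stdGaussian) (X := id) (t := -K) (-K)
    (by linarith) (integrable_exp_mul_gaussianReal (-K))
  rw [hmgf, ← Real.exp_add] at h1 h2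
  have hsub : (Set.Icc (-K) K)ᶜ ⊆ {x : ℝ | K ≤ id x} ∪ {x : ℝ | id x ≤ -K} := fun x hx => by
    by_contra hc
    simp only [Set.mem_union, Set.mem_ofPred_eq, id, not_or, not_le] at hc
    exact hx ⟨hc.2.le, hc.1.le⟩
  refine (measureReal_mono hsub).trans ((measureReal_union_le _ _).trans ?_)
  rw [two_mul]
  refine add_le_add (h1.trans (Real.exp_le_exp.2 ?_)) (h2.trans (Real.exp_le_exp.2 ?_)) <;>
    nlinarith

theorem setIntegral_stdGaussian_exp_sq_le {K μ m : ℝ} (hK : 0 ≤ K) (hμ : |μ| ≤ m) :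
    ∫ x in Set.Icc (-K) K, Real.exp ((μ + x) ^ 2 / 2) ∂stdGaussian ≤
      2 * K * Real.exp (m * K + m ^ 2 / 2) := by
  rw [← integral_indicator measurableSet_Icc, stdGaussian,
    integral_gaussianReal_eq_integral_smul one_ne_zero]
  have hind : ∀ x, gaussianPDFReal 0 1 x •
      (Set.Icc (-K) K).indicator (fun x => Real.exp ((μ + x) ^ 2 / 2)) x =
      (Set.Icc (-K) K).indicator
        (fun x => gaussianPDFReal 0 1 x * Real.exp ((μ + x) ^ 2 / 2)) x := fun x => by
    by_cases hx : x ∈ Set.Icc (-K) K <;> simp [hx]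
  simp_rw [hind]
  rw [integral_indicator measurableSet_Icc]
  have hbd : ∀ x ∈ Set.Icc (-K) K,
      ‖gaussianPDFReal 0 1 x * Real.exp ((μ + x) ^ 2 / 2)‖ ≤ Real.exp (m * K + m ^ 2 / 2) := by
    intro x hx
    have hpi : (√(2 * Real.pi))⁻¹ ≤ 1 := by
      refine inv_le_one_of_one_le₀ (Real.one_le_sqrt.2 ?_)
      linarith [Real.two_le_pi]
    rw [Real.norm_of_nonneg (mul_nonneg (gaussianPDFReal_nonneg _ _ _) (Real.exp_pos _).le),
      gaussianPDFReal]
    simp only [NNReal.coe_one, mul_one, sub_zero]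
    rw [mul_assoc, ← Real.exp_add]
    refine (mul_le_of_le_one_left (Real.exp_pos _).le hpi).trans (Real.exp_le_exp.2 ?_)
    have hx' : |x| ≤ K := abs_le.2 hx
    have h1 : μ * x ≤ m * K := (le_abs_self _).trans ((abs_mul μ x).le.trans
      (mul_le_mul hμ hx' (abs_nonneg x) ((abs_nonneg μ).trans hμ)))
    have h2 : μ ^ 2 ≤ m ^ 2 := sq_le_sq' (abs_le.1 hμ).1 (abs_le.1 hμ).2
    nlinarith
  refine (le_abs_self _).trans ((norm_setIntegral_le_of_norm_le_const (by simp) hbd).trans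
    (le_of_eq ?_))
  rw [measureReal_def, Real.volume_Icc, ENNReal.toReal_ofReal (by linarith)]
  ring

theorem measurePreserving_ssNoise_eval {n : ℕ} {p : ℕ × ℕ} (hp : p ∈ allNodes n) :
    MeasurePreserving (fun ε : ℕ × ℕ → ℝ => ε p) (ssNoise n) stdGaussian := by
  refine ⟨measurable_pi_apply p, ?_⟩
  rw [ssNoise, Measure.map_map (measurable_pi_apply p) (measurable_embedFin _)]
  have hcomp : (fun ε : ℕ × ℕ → ℝ => ε p) ∘ embedFin (allNodes n) =
      Function.eval (⟨p, hp⟩ : {p : ℕ × ℕ // p ∈ allNodes n}) := by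
    ext v
    simp [embedFin, hp]
  rw [hcomp]
  exact (measurePreserving_eval (fun _ : {p : ℕ × ℕ // p ∈ allNodes n} => stdGaussian) _).map_eq

theorem integral_ssNoise_le {n : ℕ} {Q : Finset (ℕ × ℕ)} (hQ : Q ⊆ allNodes n) {K : ℝ}
    (hK : 0 ≤ K) {b : ℕ × ℕ → ℝ → ℝ} (hb : ∀ p, Continuous (b p)) {e : ℕ × ℕ → ℝ}
    (he : ∀ p ∈ Q, ∫ x in Set.Icc (-K) K, b p x ∂stdGaussian ≤ e p)
    {F : (ℕ × ℕ → ℝ) → ℝ} (hF : ∀ ε, 0 ≤ F ε)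
    (hFb : ∀ ε, F ε ≤ ∑ p ∈ Q, (Set.Icc (-K) K).piecewise (b p) (fun _ => 1) (ε p)) :
    ∫ ε, F ε ∂ssNoise n ≤ ∑ p ∈ Q, (e p + 2 * Real.exp (-K ^ 2 / 2)) := by
  have hbK : ∀ p, IntegrableOn (b p) (Set.Icc (-K) K) stdGaussian := fun p =>
    (hb p).continuousOn.integrableOn_Icc
  have hint : ∀ p, Integrable ((Set.Icc (-K) K).piecewise (b p) (fun _ => 1)) stdGaussian :=
    fun p => Integrable.piecewise measurableSet_Icc (hbK p) (integrable_const _).integrableOn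
  have hintn : ∀ p ∈ Q, Integrable
      (fun ε : ℕ × ℕ → ℝ => (Set.Icc (-K) K).piecewise (b p) (fun _ => 1) (ε p)) (ssNoise n) :=
    fun p hp => (measurePreserving_ssNoise_eval (hQ hp)).integrable_comp_of_integrable (hint p)
  refine (integral_mono_of_nonneg (ae_of_all _ hF) (integrable_finsetSum Q hintn)
    (ae_of_all _ hFb)).trans ?_
  rw [integral_finsetSum Q hintn]
  refine Finset.sum_le_sum fun p hp => ?_
  have hmp := measurePreserving_ssNoise_eval (hQ hp)
  have hmap : ∫ ε, (Set.Icc (-K) K).piecewise (b p) (fun _ => 1) (ε p) ∂ssNoise n =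
      ∫ x, (Set.Icc (-K) K).piecewise (b p) (fun _ => 1) x ∂stdGaussian := by
    rw [← hmp.map_eq, integral_map hmp.measurable.aemeasurable]
    rw [hmp.map_eq]
    exact (hint p).aestronglyMeasurable
  rw [hmap, integral_piecewise measurableSet_Icc (hbK p) (integrable_const _).integrableOn]
  refine add_le_add (he p hp) ?_
  simpa using stdGaussian_real_compl_Icc_le hK

theorem sum_allNodes (n : ℕ) (f : ℕ → ℝ) :
    ∑ p ∈ allNodes n, f p.1 = ∑ l ∈ Finset.range (Lmax n + 1), 2 ^ l * f l := by
  rw [allNodes, Finset.sum_biUnion]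
  · refine Finset.sum_congr rfl fun l _ => ?_
    rw [Finset.sum_image fun k _ k' _ h => (Prod.mk.inj h).2]
    simp
  · intro l _ l' _ hll
    rw [Function.onFun, Finset.disjoint_left]
    intro p hp hp'
    obtain ⟨k, _, rfl⟩ := Finset.mem_image.1 hp
    obtain ⟨k', _, h⟩ := Finset.mem_image.1 hp'
    exact hll (Prod.mk.inj h).1.symm

theorem fst_le_Lmax {n : ℕ} {p : ℕ × ℕ} (hp : p ∈ allNodes n) : p.1 ≤ Lmax n := by
  simp only [allNodes, Finset.mem_biUnion, Finset.mem_range, Finset.mem_image] at hp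
  obtain ⟨l, hl, k, _, rfl⟩ := hp
  exact Nat.lt_succ_iff.1 hl

theorem card_allNodes_le {n : ℕ} (hn : 0 < n) : ((allNodes n).card : ℝ) ≤ 2 * n := by
  have h := sum_allNodes n fun _ => 1
  simp only [Finset.sum_const, nsmul_eq_mul, mul_one] at h
  rw [h, geom_sum_eq (by norm_num), pow_succ]
  have : (2 : ℝ) ^ Lmax n ≤ n := by exact_mod_cast Nat.pow_log_le_self 2 hn.ne'
  linarith

theorem abs_coef_le {f : ℝ → ℝ} {B : ℝ} (hf : ∀ x ∈ Set.Icc (0 : ℝ) 1, |f x| ≤ B) (l k : ℕ) :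
    |coef f l k| ≤ B := by
  have hB : 0 ≤ B := (abs_nonneg _).trans (hf 0 (by simp))
  have h2 : (0 : ℝ) < 2 ^ l := by positivity
  set c : ℝ := B * (2 : ℝ) ^ ((l : ℝ) / 2) with hc
  have hc0 : 0 ≤ c := by positivity
  have hle : ∀ x ∈ Set.Ioc (0 : ℝ) 1,
      ‖f x * haar l k x‖ ≤ (dyadic l k).indicator (fun _ => c) x := by
    intro x hx
    by_cases hxd : x ∈ dyadic l k
    · rw [Set.indicator_of_mem hxd, norm_mul, haar, norm_mul, hc]
      have hpsi : ‖psi ((2 : ℝ) ^ l * x - k)‖ ≤ 1 := by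
        unfold psi
        split_ifs <;> simp
      refine mul_le_mul (hf x (Set.Ioc_subset_Icc_self hx)) ?_ (by positivity) hB
      rw [Real.norm_of_nonneg (by positivity)]
      exact mul_le_of_le_one_right (by positivity) hpsi
    · have hpsi : psi ((2 : ℝ) ^ l * x - k) = 0 := by
        simp only [dyadic, Set.mem_Ioc, div_lt_iff₀ h2, le_div_iff₀ h2, not_and_or, not_lt,
          not_le] at hxd
        unfold psi
        rw [if_neg, if_neg] <;> rintro ⟨h3, h4⟩ <;> rcases hxd with h | h <;> nlinarith
      simp [haar, hpsi, hxd]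
  have hint : Integrable ((dyadic l k).indicator fun _ => c) volume :=
    (integrable_indicator_iff measurableSet_Ioc).2 (integrableOn_const (by simp))
  refine (norm_integral_le_of_norm_le hint.integrableOn
    ((ae_restrict_iff' measurableSet_Ioc).2 (ae_of_all _ hle))).trans
    ((setIntegral_le_integral hint (ae_of_all _ fun x =>
      Set.indicator_nonneg (fun _ _ => hc0) x)).trans ?_)
  rw [integral_indicator (s := dyadic l k) measurableSet_Ioc, setIntegral_const, dyadic, measureReal_def,
    Real.volume_Ioc, smul_eq_mul, ← sub_div, add_sub_cancel_left,
    ENNReal.toReal_ofReal (by positivity), hc, mul_comm, mul_assoc]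
  refine mul_le_of_le_one_right hB ?_
  rw [mul_one_div, div_le_one h2, ← Real.rpow_natCast]
  exact Real.rpow_le_rpow_of_exponent_le one_le_two (by
    have : (0 : ℝ) ≤ l := by positivity
    linarith)

theorem half_mul_ssObs_sq (f₀ : ℝ → ℝ) {n : ℕ} (hn : 0 < n) (ε : ℕ × ℕ → ℝ) (p : ℕ × ℕ) :
    (n : ℝ) / 2 * ssObs f₀ n ε p ^ 2 = (√n * coef f₀ p.1 p.2 + ε p) ^ 2 / 2 := by
  have hn' : (0 : ℝ) < n := by exact_mod_cast hn
  have hs : √(n : ℝ) ≠ 0 := (Real.sqrt_pos.2 hn').ne'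
  have h : √n * coef f₀ p.1 p.2 + ε p = √n * ssObs f₀ n ε p := by
    rw [ssObs]
    field_simp
  rw [h, mul_pow, Real.sq_sqrt hn'.le]
  ring

section Posterior

variable {n : ℕ} {P : SSPrior n} {cT CT Bω δ R cR CR : ℝ} {ω : ℕ → ℝ}

theorem A2.integral_ssSetPost_not_subset_le (h : A2 n P cT CT Bω δ R cR CR ω) (hn : 0 < n)
    (hCT : 0 < CT) (hCR : 0 < CR) (f₀ : ℝ → ℝ) {a K : ℝ} (hK : 0 ≤ K) :
    ∫ ε, ssSetPost n P (ssObs f₀ n ε) {T | ¬T ⊆ sigSet f₀ n a} ∂ssNoise n ≤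
      ∑ p ∈ allNodes n, (CT * ω p.1 * (CR * √(2 * Real.pi / n)) *
        (2 * K * Real.exp (a * √(Real.log n) * K + (a * √(Real.log n)) ^ 2 / 2)) +
        2 * Real.exp (-K ^ 2 / 2)) := by
  have hn' : (0 : ℝ) < n := by exact_mod_cast hn
  have hs : 0 < √(n : ℝ) := Real.sqrt_pos.2 hn'
  have hc : ∀ p ∈ allNodes n, 0 ≤ CT * ω p.1 * (CR * √(2 * Real.pi / n)) := fun p hp => by
    have := h.ω_pos p.1 (fst_le_Lmax hp)
    positivity
  have hQ : allNodes n \ sigSet f₀ n a ⊆ allNodes n := Finset.sdiff_subset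
  refine (integral_ssNoise_le hQ hK
    (b := fun p x => CT * ω p.1 * (CR * √(2 * Real.pi / n)) *
      Real.exp ((√n * coef f₀ p.1 p.2 + x) ^ 2 / 2))
    (e := fun p => CT * ω p.1 * (CR * √(2 * Real.pi / n)) *
      (2 * K * Real.exp (a * √(Real.log n) * K + (a * √(Real.log n)) ^ 2 / 2)))
    (fun p => by fun_prop) (fun p hp => ?_) (fun ε => h.ssSetPost_nonneg _ _)
    fun ε => ?_).trans ?_
  · rw [integral_const_mul]
    refine mul_le_mul_of_nonneg_left (setIntegral_stdGaussian_exp_sq_le hK ?_) (hc p (hQ hp))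
    have hβ : |coef f₀ p.1 p.2| ≤ a * √(Real.log n / n) := by
      by_contra hlt
      exact (Finset.mem_sdiff.1 hp).2 (Finset.mem_filter.2 ⟨hQ hp, not_le.1 hlt⟩)
    rw [Real.sqrt_div' _ hn'.le] at hβ
    rw [abs_mul, abs_of_pos hs]
    calc √n * |coef f₀ p.1 p.2| ≤ √n * (a * (√(Real.log n) / √n)) := by gcongr
      _ = a * √(Real.log n) := by field_simp
  · have hg : ∀ T, 0 ≤ P.w T * ssMarg n P (ssObs f₀ n ε) T := fun T =>
      mul_nonneg (h.w_nonneg T) (ssMarg_nonneg n P _ T)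
    refine h.ssSetPost_le _ (C := fun p T => p ∈ T)
      (b := fun p => (Set.Icc (-K) K).piecewise (fun x => CT * ω p.1 * (CR * √(2 * Real.pi / n)) *
        Real.exp ((√n * coef f₀ p.1 p.2 + x) ^ 2 / 2)) (fun _ => 1) (ε p))
      (fun T hT hTA => ?_) (fun p hp => ?_) fun p hp => ?_
    · obtain ⟨p, hpT, hpS⟩ := Finset.not_subset.1 hTA
      exact ⟨p, Finset.mem_sdiff.2 ⟨hT hpT, hpS⟩, hpT⟩
    · by_cases hε : ε p ∈ Set.Icc (-K) K
      · rw [Set.piecewise_eq_of_mem _ _ _ hε]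
        exact mul_nonneg (hc p (hQ hp)) (Real.exp_pos _).le
      · rw [Set.piecewise_eq_of_notMem _ _ _ hε]
        exact zero_le_one
    · by_cases hε : ε p ∈ Set.Icc (-K) K
      · rw [Set.piecewise_eq_of_mem _ _ _ hε]
        refine sum_powerset_mem_le hg (hQ hp) (mul_nonneg (hc p (hQ hp)) (Real.exp_pos _).le)
          fun T hT hpT => ?_
        rw [h.ssMarg_insert _ hT (hQ hp) hpT, half_mul_ssObs_sq f₀ hn]
        have hω := h.ω_pos p.1 (fst_le_Lmax (hQ hp))
        have hm := ssMarg_nonneg n P (ssObs f₀ n ε) T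
        have hw := h.w_nonneg T
        calc _ ≤ (CT * ω p.1 * P.w T) * (Real.exp ((√n * coef f₀ p.1 p.2 + ε p) ^ 2 / 2) *
              (CR * √(2 * Real.pi / n)) * ssMarg n P (ssObs f₀ n ε) T) := by
              refine mul_le_mul (h.ratio_ub T p (hQ hp) hpT) ?_ ?_ (by positivity)
              · gcongr
                exact h.slabMarg_le hn p _
              · have : 0 ≤ slabMarg n P p (ssObs f₀ n ε p) :=
                  integral_nonneg fun b => mul_nonneg (Real.exp_pos _).le (h.slab_nonneg p b)
                positivity
          _ = _ := by ring
      · rw [Set.piecewise_eq_of_notMem _ _ _ hε, one_mul]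
        exact Finset.sum_le_sum_of_subset_of_nonneg (Finset.filter_subset _ _) fun T _ _ => hg T
  · refine Finset.sum_le_sum_of_subset_of_nonneg hQ fun p hp _ => ?_
    have := hc p hp
    positivity

theorem A2.integral_ssSetPost_not_superset_le (h : A2 n P cT CT Bω δ R cR CR ω) (hn : 0 < n)
    (hcT : 0 < cT) (hcR : 0 < cR) {f₀ : ℝ → ℝ} {Mb A K m : ℝ} (hK : 0 ≤ K) (hm : 0 ≤ m)
    (hf₀ : ∀ x ∈ Set.Icc (0 : ℝ) 1, |f₀ x| ≤ Mb) (hR : Mb + (K + 1) / √n ≤ R)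
    (hA : m + K ≤ A * √(Real.log n)) :
    ∫ ε, ssSetPost n P (ssObs f₀ n ε) {T | ¬sigSet f₀ n A ⊆ T} ∂ssNoise n ≤
      ∑ p ∈ allNodes n, (√n * Real.exp (1 / 2) / (2 * cR * (cT * ω p.1)) * Real.exp (-m ^ 2 / 2) +
        2 * Real.exp (-K ^ 2 / 2)) := by
  have hn' : (0 : ℝ) < n := by exact_mod_cast hn
  have hs : 0 < √(n : ℝ) := Real.sqrt_pos.2 hn'
  have hc : ∀ p ∈ allNodes n,
      0 ≤ √n * Real.exp (1 / 2) / (2 * cR * (cT * ω p.1)) * Real.exp (-m ^ 2 / 2) := fun p hp => by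
    have := h.ω_pos p.1 (fst_le_Lmax hp)
    positivity
  have hQ : sigSet f₀ n A ⊆ allNodes n := Finset.filter_subset _ _
  refine (integral_ssNoise_le hQ hK
    (b := fun p _ => √n * Real.exp (1 / 2) / (2 * cR * (cT * ω p.1)) * Real.exp (-m ^ 2 / 2))
    (e := fun p => √n * Real.exp (1 / 2) / (2 * cR * (cT * ω p.1)) * Real.exp (-m ^ 2 / 2))
    (fun p => by fun_prop) (fun p hp => ?_) (fun ε => h.ssSetPost_nonneg _ _)
    fun ε => ?_).trans ?_
  · rw [setIntegral_const, smul_eq_mul]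
    exact mul_le_of_le_one_left (hc p (hQ hp)) measureReal_le_one
  · have hg : ∀ T, 0 ≤ P.w T * ssMarg n P (ssObs f₀ n ε) T := fun T =>
      mul_nonneg (h.w_nonneg T) (ssMarg_nonneg n P _ T)
    refine h.ssSetPost_le _ (C := fun p T => p ∉ T)
      (b := fun p => (Set.Icc (-K) K).piecewise (fun _ => √n * Real.exp (1 / 2) /
        (2 * cR * (cT * ω p.1)) * Real.exp (-m ^ 2 / 2)) (fun _ => 1) (ε p))
      (fun T hT hTA => ?_) (fun p hp => ?_) fun p hp => ?_
    · obtain ⟨p, hpS, hpT⟩ := Finset.not_subset.1 hTA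
      exact ⟨p, hpS, hpT⟩
    · by_cases hε : ε p ∈ Set.Icc (-K) K
      · rw [Set.piecewise_eq_of_mem _ _ _ hε]
        exact hc p (hQ hp)
      · rw [Set.piecewise_eq_of_notMem _ _ _ hε]
        exact zero_le_one
    · by_cases hε : ε p ∈ Set.Icc (-K) K
      · rw [Set.piecewise_eq_of_mem _ _ _ hε]
        refine sum_powerset_notMem_le hg (hQ hp) (hc p (hQ hp)) fun T hT hpT => ?_
        rw [h.ssMarg_insert _ hT (hQ hp) hpT, half_mul_ssObs_sq f₀ hn]
        have hω := h.ω_pos p.1 (fst_le_Lmax (hQ hp))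
        have hmarg := ssMarg_nonneg n P (ssObs f₀ n ε) T
        have hw := h.w_nonneg T
        have hεK : |ε p| ≤ K := abs_le.2 hε
        have hβ : A * √(Real.log n) < √n * |coef f₀ p.1 p.2| := by
          have := (Finset.mem_filter.1 hp).2
          rw [Real.sqrt_div' _ hn'.le, ← mul_div_assoc, div_lt_iff₀ hs] at this
          linarith
        have hsq : Real.exp (m ^ 2 / 2) ≤ Real.exp ((√n * coef f₀ p.1 p.2 + ε p) ^ 2 / 2) := by
          have h1 : m ≤ |√n * coef f₀ p.1 p.2 + ε p| := by
            have h2 := abs_sub_abs_le_abs_sub (√n * coef f₀ p.1 p.2) (-ε p)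
            rw [abs_mul, abs_of_pos hs, abs_neg, sub_neg_eq_add] at h2
            linarith
          have h2 := pow_le_pow_left₀ hm h1 2
          rw [sq_abs] at h2
          exact Real.exp_le_exp.2 (by linarith)
        have hy : |ssObs f₀ n ε p| + 1 / √n ≤ R := by
          have h1 : |ssObs f₀ n ε p| ≤ Mb + K / √n := by
            refine (abs_add_le _ _).trans (add_le_add (abs_coef_le hf₀ _ _) ?_)
            rw [abs_div, abs_of_pos hs]
            gcongr
          rw [add_div] at hR
          linarith
        calc P.w T * ssMarg n P (ssObs f₀ n ε) T
            = √n * Real.exp (1 / 2) / (2 * cR * (cT * ω p.1)) * Real.exp (-m ^ 2 / 2) *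
              ((cT * ω p.1 * P.w T) * (Real.exp (m ^ 2 / 2) *
                (2 * cR * Real.exp (-(1 / 2)) / √n) * ssMarg n P (ssObs f₀ n ε) T)) := by
              rw [neg_div, Real.exp_neg, Real.exp_neg]
              field_simp
          _ ≤ _ := by
              refine mul_le_mul_of_nonneg_left ?_ (hc p (hQ hp))
              refine mul_le_mul (h.ratio_lb T p (hQ hp) hpT) ?_ (by positivity) (h.w_nonneg _)
              gcongr
              exact h.le_slabMarg hn hcR p hy
      · rw [Set.piecewise_eq_of_notMem _ _ _ hε, one_mul]
        exact Finset.sum_le_sum_of_subset_of_nonneg (Finset.filter_subset _ _) fun T _ _ => hg T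
  · refine Finset.sum_le_sum_of_subset_of_nonneg hQ fun p hp _ => ?_
    have := hc p hp
    positivity

end Posterior

theorem Lmax_le {n : ℕ} (hn : 0 < n) : (Lmax n : ℝ) ≤ 2 * Real.log n := by
  have hn' : (0 : ℝ) < n := by exact_mod_cast hn
  have h1 : (2 : ℝ) ^ Lmax n ≤ n := by exact_mod_cast Nat.pow_log_le_self 2 hn.ne'
  have h2 := Real.log_le_log (by positivity) h1
  rw [Real.log_pow] at h2
  have h3 : (0 : ℝ) ≤ Lmax n := by positivity
  nlinarith [Real.log_two_gt_d9]

theorem tendsto_log_pow_mul_exp_neg (k : ℕ) {c : ℝ} (hc : 0 < c) :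
    Tendsto (fun n : ℕ => Real.log n ^ k * Real.exp (-(c * Real.log n))) atTop (nhds 0) := by
  have h := (isLittleO_pow_exp_pos_mul_atTop k hc).tendsto_div_nhds_zero
  refine (h.comp (Real.tendsto_log_atTop.comp tendsto_natCast_atTop_atTop)).congr fun n => ?_
  simp [Real.exp_neg, div_eq_mul_inv]

theorem A2.sum_ω_le {n : ℕ} {P : SSPrior n} {cT CT Bω δ R cR CR : ℝ} {ω : ℕ → ℝ}
    (h : A2 n P cT CT Bω δ R cR CR ω) :
    ∑ p ∈ allNodes n, ω p.1 ≤ (Lmax n + 1) * (n : ℝ) ^ ((1 - δ) / 2) := by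
  rw [sum_allNodes]
  refine (Finset.sum_le_card_nsmul _ _ ((n : ℝ) ^ ((1 - δ) / 2)) fun l hl => ?_).trans_eq (by simp)
  have := h.ω_ub l (Nat.lt_succ_iff.1 (Finset.mem_range.1 hl))
  rwa [le_div_iff₀ (by positivity), mul_comm] at this

theorem one_le_log {n : ℕ} (hn : 3 ≤ n) : 1 ≤ Real.log n := by
  have hn' : (3 : ℝ) ≤ n := by exact_mod_cast hn
  rw [Real.le_log_iff_exp_le (by linarith)]
  linarith [Real.exp_one_lt_d9]

theorem sqrt_eq_exp_half_log {n : ℕ} (hn : 0 < n) : √(n : ℝ) = Real.exp (Real.log n / 2) := by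
  rw [Real.exp_half, Real.exp_log (by exact_mod_cast hn)]

theorem card_allNodes_mul_le {n : ℕ} (hn : 3 ≤ n) :
    ((allNodes n).card : ℝ) * (2 * Real.exp (-(2 * √(Real.log n)) ^ 2 / 2)) ≤
      4 * Real.exp (-Real.log n) := by
  have hL := one_le_log hn
  have hn' : (0 : ℝ) < n := by exact_mod_cast (by omega : 0 < n)
  have hexp : Real.exp (-(2 * √(Real.log n)) ^ 2 / 2) =
      Real.exp (-Real.log n) * (n : ℝ)⁻¹ := by
    rw [neg_div, mul_pow, Real.sq_sqrt (by linarith)]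
    conv_rhs => rw [← Real.exp_log hn', ← Real.exp_neg, Real.log_exp, ← Real.exp_add]
    congr 1
    ring
  rw [hexp]
  refine (mul_le_mul_of_nonneg_right (card_allNodes_le (by omega)) (by positivity)).trans_eq ?_
  field_simp
  norm_num

section Rates

variable {n : ℕ} {P : SSPrior n} {cT CT Bω δ R cR CR : ℝ} {ω : ℕ → ℝ}

theorem A2.sum_small_node_bound_le (h : A2 n P cT CT Bω δ R cR CR ω) (hn : 3 ≤ n)
    (hCT : 0 < CT) (hCR : 0 < CR) {a : ℝ} (ha0 : 0 ≤ a) (ha1 : a ≤ 1) (haδ : a ≤ δ / 8) :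
    ∑ p ∈ allNodes n, (CT * ω p.1 * (CR * √(2 * Real.pi / n)) *
        (2 * (2 * √(Real.log n)) * Real.exp (a * √(Real.log n) * (2 * √(Real.log n)) +
          (a * √(Real.log n)) ^ 2 / 2)) + 2 * Real.exp (-(2 * √(Real.log n)) ^ 2 / 2)) ≤
      12 * (CT * CR * √(2 * Real.pi)) *
        (Real.log n ^ 2 * Real.exp (-(3 * δ / 16 * Real.log n))) +
      4 * (Real.log n ^ 0 * Real.exp (-(1 * Real.log n))) := by
  have hn0 : 0 < n := by omega
  have hn' : (0 : ℝ) < n := by exact_mod_cast hn0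
  have hL := one_le_log hn
  rw [Finset.sum_add_distrib, Finset.sum_const, nsmul_eq_mul, pow_zero, one_mul, one_mul]
  refine add_le_add ?_ (card_allNodes_mul_le hn)
  have hfac : a * √(Real.log n) * (2 * √(Real.log n)) + (a * √(Real.log n)) ^ 2 / 2 =
      (2 * a + a ^ 2 / 2) * Real.log n := by
    have := Real.mul_self_sqrt (by linarith : 0 ≤ Real.log n)
    linear_combination (2 * a + a ^ 2 / 2) * this
  have hsum : ∑ p ∈ allNodes n, ω p.1 ≤
      3 * Real.log n * Real.exp (Real.log n * ((1 - δ) / 2)) := by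
    refine h.sum_ω_le.trans ?_
    rw [Real.rpow_def_of_pos hn']
    have := Lmax_le hn0
    gcongr
    linarith
  have hsqrt : √(2 * Real.pi / n) = √(2 * Real.pi) * Real.exp (-(Real.log n / 2)) := by
    rw [Real.sqrt_div' _ hn'.le, sqrt_eq_exp_half_log hn0, Real.exp_neg, div_eq_mul_inv]
  have hroot : √(Real.log n) ≤ Real.log n := Real.sqrt_le_iff.2 ⟨by linarith, by nlinarith⟩
  have hexp : (2 * a + a ^ 2 / 2) * Real.log n + -(Real.log n / 2) +
      Real.log n * ((1 - δ) / 2) ≤ -(3 * δ / 16 * Real.log n) := by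
    have : 2 * a + a ^ 2 / 2 - δ / 2 + 3 * δ / 16 ≤ 0 := by nlinarith
    nlinarith
  rw [hfac, hsqrt]
  calc _ = CT * CR * √(2 * Real.pi) * (4 * √(Real.log n)) *
        (Real.exp ((2 * a + a ^ 2 / 2) * Real.log n) * Real.exp (-(Real.log n / 2))) *
        ∑ p ∈ allNodes n, ω p.1 := by
        rw [Finset.mul_sum]
        exact Finset.sum_congr rfl fun p _ => by ring
    _ ≤ CT * CR * √(2 * Real.pi) * (4 * Real.log n) *
        (Real.exp ((2 * a + a ^ 2 / 2) * Real.log n) * Real.exp (-(Real.log n / 2))) *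
        (3 * Real.log n * Real.exp (Real.log n * ((1 - δ) / 2))) := by
        have := Finset.sum_nonneg fun p hp => (h.ω_pos (Prod.fst p) (fst_le_Lmax hp)).le
        gcongr
    _ = 12 * (CT * CR * √(2 * Real.pi)) * (Real.log n ^ 2 *
        Real.exp ((2 * a + a ^ 2 / 2) * Real.log n + -(Real.log n / 2) +
          Real.log n * ((1 - δ) / 2))) := by
        rw [Real.exp_add, Real.exp_add]
        ring
    _ ≤ _ := by gcongr

theorem A2.sum_large_node_bound_le (h : A2 n P cT CT Bω δ R cR CR ω) (hn : 3 ≤ n)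
    (hcT : 0 < cT) (hcR : 0 < cR) (hBω : 0 < Bω) :
    ∑ p ∈ allNodes n, (√n * Real.exp (1 / 2) / (2 * cR * (cT * ω p.1)) *
        Real.exp (-((Bω + 2) * √(Real.log n)) ^ 2 / 2) +
        2 * Real.exp (-(2 * √(Real.log n)) ^ 2 / 2)) ≤
      Real.exp (1 / 2) / (cR * cT) * (Real.log n ^ 0 * Real.exp (-(1 / 2 * Real.log n))) +
      4 * (Real.log n ^ 0 * Real.exp (-(1 * Real.log n))) := by
  have hn0 : 0 < n := by omega
  have hn' : (0 : ℝ) < n := by exact_mod_cast hn0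
  have hL := one_le_log hn
  rw [Finset.sum_add_distrib, Finset.sum_const, nsmul_eq_mul, pow_zero, one_mul, one_mul, one_mul]
  refine add_le_add ?_ (card_allNodes_mul_le hn)
  have hterm : ∀ p ∈ allNodes n, √n * Real.exp (1 / 2) / (2 * cR * (cT * ω p.1)) *
      Real.exp (-((Bω + 2) * √(Real.log n)) ^ 2 / 2) ≤
      Real.exp (1 / 2) / (2 * (cR * cT)) * Real.exp (-(3 / 2 * Real.log n)) := fun p hp => by
    have hl := fst_le_Lmax hp
    have hω := h.ω_pos p.1 hl
    have hlb := h.ω_lb p.1 hl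
    rw [Real.rpow_def_of_pos hn'] at hlb
    rw [neg_div, mul_pow, Real.sq_sqrt (by linarith), sqrt_eq_exp_half_log hn0]
    calc _ ≤ Real.exp (Real.log n / 2) * Real.exp (1 / 2) /
          (2 * cR * (cT * Real.exp (Real.log n * -Bω))) *
          Real.exp (-((Bω + 2) ^ 2 * Real.log n / 2)) := by gcongr
      _ = Real.exp (1 / 2) / (2 * (cR * cT)) * Real.exp (Real.log n / 2 + Real.log n * Bω +
          -((Bω + 2) ^ 2 * Real.log n / 2)) := by
          rw [mul_neg, Real.exp_neg (Real.log n * Bω), Real.exp_add, Real.exp_add]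
          field_simp
      _ ≤ _ := by
          gcongr
          nlinarith [mul_pos hBω hBω, mul_pos hBω (by linarith : 0 < Real.log n)]
  refine (Finset.sum_le_card_nsmul _ _ _ hterm).trans ?_
  rw [nsmul_eq_mul]
  refine (mul_le_mul_of_nonneg_right (card_allNodes_le hn0) (by positivity)).trans_eq ?_
  have hexp : (n : ℝ) * Real.exp (-(3 / 2 * Real.log n)) = Real.exp (-(1 / 2 * Real.log n)) := by
    conv_lhs => rw [← Real.exp_log hn', Real.log_exp, ← Real.exp_add]
    congr 1
    ring
  rw [← hexp]
  field_simp

end Rates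

/-- Lemma 3.1: under the spike-and-slab prior the posterior active set
contains no too-small coefficients and contains all large ones: there exist a > 0
(determined by δ) and A > a such that, uniformly over the class,
E Π[T : T ∩ S(f₀,a)^c ≠ ∅ | Y] = o(1) and E Π[T : S(f₀,A) ⊄ T | Y] = o(1). -/
theorem statement8 (t M η : ℝ → ℝ) (t₁ : ℝ) (hA1 : A1 t M η t₁)
    (cT CT Bω δ R cR CR : ℝ)
    (hcT : 0 < cT) (hCT : 0 < CT) (hBω : 0 < Bω) (hδ : 1 / 4 < δ)
    (hcR : 0 < cR) (hCR : 0 < CR)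
    (hR : ∃ Mb : ℝ, (∀ x ∈ Set.Icc (0 : ℝ) 1, M x ≤ Mb) ∧ Mb < R)
    (P : ∀ n : ℕ, SSPrior n) (ω : ℕ → ℕ → ℝ)
    (hA2 : ∀ n : ℕ, 2 ≤ n → A2 n (P n) cT CT Bω δ R cR CR (ω n)) :
    ∃ a > (0 : ℝ), ∃ A > a,
      (∀ δ' > (0 : ℝ), ∃ N : ℕ, ∀ n ≥ N, ∀ f₀ ∈ HolderClass t M η,
        (∫ ε, ssSetPost n (P n) (ssObs f₀ n ε)
            {T : Finset (ℕ × ℕ) | ¬T ⊆ sigSet f₀ n a} ∂ssNoise n) ≤ δ') ∧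
      (∀ δ' > (0 : ℝ), ∃ N : ℕ, ∀ n ≥ N, ∀ f₀ ∈ HolderClass t M η,
        (∫ ε, ssSetPost n (P n) (ssObs f₀ n ε)
            {T : Finset (ℕ × ℕ) | ¬sigSet f₀ n A ⊆ T} ∂ssNoise n) ≤ δ') := by
  obtain ⟨Mb, hMb, hMbR⟩ := hR
  have ha1 : min 1 (δ / 8) ≤ 1 := min_le_left _ _
  have ha2 : min 1 (δ / 8) ≤ δ / 8 := min_le_right _ _
  have ha0 : 0 < min 1 (δ / 8) := lt_min one_pos (by linarith)
  refine ⟨min 1 (δ / 8), ha0, Bω + 4, by linarith, fun δ' hδ' => ?_, fun δ' hδ' => ?_⟩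
  · have hlim := ((tendsto_log_pow_mul_exp_neg 2 (c := 3 * δ / 16) (by linarith)).const_mul
      (12 * (CT * CR * √(2 * Real.pi)))).add
      ((tendsto_log_pow_mul_exp_neg 0 one_pos).const_mul 4)
    rw [mul_zero, mul_zero, add_zero] at hlim
    obtain ⟨N, hN⟩ := eventually_atTop.1 (hlim.eventually_le_const hδ')
    refine ⟨max N 3, fun n hn f₀ _ => le_trans ?_ (hN n (le_of_max_le_left hn))⟩
    have hn3 : 3 ≤ n := le_of_max_le_right hn
    exact ((hA2 n (by omega)).integral_ssSetPost_not_subset_le (by omega) hCT hCR f₀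
      (K := 2 * √(Real.log n)) (by positivity)).trans
      ((hA2 n (by omega)).sum_small_node_bound_le hn3 hCT hCR ha0.le ha1 ha2)
  · have hlim := ((tendsto_log_pow_mul_exp_neg 0 (c := 1 / 2) (by norm_num)).const_mul
      (Real.exp (1 / 2) / (cR * cT))).add
      ((tendsto_log_pow_mul_exp_neg 0 one_pos).const_mul 4)
    rw [mul_zero, mul_zero, add_zero] at hlim
    have hlim' := (tendsto_log_pow_mul_exp_neg 1 (c := 1 / 2) (by norm_num)).const_mul 3
    rw [mul_zero] at hlim'
    obtain ⟨N, hN⟩ := eventually_atTop.1 ((hlim.eventually_le_const hδ').and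
      (hlim'.eventually_le_const (sub_pos.2 hMbR)))
    refine ⟨max N 3, fun n hn f₀ hf₀ => le_trans ?_ (hN n (le_of_max_le_left hn)).1⟩
    have hn3 : 3 ≤ n := le_of_max_le_right hn
    have hL := one_le_log hn3
    have hK : (2 * √(Real.log n) + 1) / √n ≤ R - Mb := by
      refine le_trans ?_ (hN n (le_of_max_le_left hn)).2
      have h1 : √(Real.log n) ≤ Real.log n := Real.sqrt_le_iff.2 ⟨by linarith, by nlinarith⟩
      rw [sqrt_eq_exp_half_log (by omega), div_eq_mul_inv, ← Real.exp_neg, pow_one, ← mul_assoc,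
        one_div_mul_eq_div]
      exact mul_le_mul_of_nonneg_right (by linarith) (Real.exp_pos _).le
    refine ((hA2 n (by omega)).integral_ssSetPost_not_superset_le (by omega) hcT hcR
      (K := 2 * √(Real.log n)) (m := (Bω + 2) * √(Real.log n)) (by positivity) (by positivity)
      (fun x hx => ((hf₀ 0 (by simp)).1 x hx).trans (hMb 0 (by simp))) (by linarith)
      (by linarith)).trans ?_
    exact (hA2 n (by omega)).sum_large_node_bound_le hn3 hcT hcR hBω

end Spatial
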